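/- arXiv:1908.07417 — 7 statements merged into one kernel-verified Lean document; each statement's English description precedes it below -/
import Mathlib

section
/- For all real parameters R0, R1 ≥ 0, R2, ν > 0 and all x > 0, the function π satisfies the stationary Fokker–Planck equation (ν²/2)·d²/dx²[x²·π(x)] = d/dx[(R0 + R1·x)(R2 − x)·π(x)]. -/
/-- Logarithmic derivative of an inverse-Gaussian type function `y ^ s * exp (-a / y - b * y)`. -/
lemma hasDerivAt_rpow_mul_exp (s a b : ℝ) {y : ℝ} (hy : 0 < y) :
    HasDerivAt (fun z : ℝ => z ^ s * Real.exp (-a * (1 / z) - b * z))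
      ((s / y + a / y ^ 2 - b) * (y ^ s * Real.exp (-a * (1 / y) - b * y))) y := by
  have hne : y ≠ 0 := hy.ne'
  have hpow : HasDerivAt (fun z : ℝ => z ^ s) (s * y ^ (s - 1)) y :=
    Real.hasDerivAt_rpow_const (Or.inl hne)
  have hinv : HasDerivAt (fun z : ℝ => 1 / z) (-(y ^ 2)⁻¹) y := by
    simpa only [one_div] using hasDerivAt_inv hne
  have hexp := ((hinv.const_mul (-a)).sub ((hasDerivAt_id' y).const_mul b)).exp
  refine (hpow.mul hexp).congr_deriv ?_
  rw [Real.rpow_sub_one hne]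
  simp only [Pi.sub_apply]
  field_simp
  ring

/-- The GIG-type stationary density `π(x) = x^(ξ-1) * exp(-(2R0R2/ν²)/x - (2R1/ν²)x)`
satisfies the stationary Fokker–Planck equation
`(ν²/2) d²/dx²[x² π(x)] = d/dx[(R0 + R1 x)(R2 - x) π(x)]` for all `x > 0`. -/
theorem stmt_0 (R0 R1 R2 ν : ℝ) (hR0 : 0 ≤ R0) (hR1 : 0 ≤ R1) (hR2 : 0 < R2) (hν : 0 < ν)
    (ξ : ℝ) (hξ : ξ = -2 * (R0 - R1 * R2) / ν ^ 2 - 1)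
    (piF : ℝ → ℝ)
    (hpi : ∀ x : ℝ, 0 < x →
      piF x = x ^ (ξ - 1) *
        Real.exp (-(2 * R0 * R2 / ν ^ 2) * (1 / x) - (2 * R1 / ν ^ 2) * x)) :
    ∀ x : ℝ, 0 < x →
      ν ^ 2 / 2 * deriv (deriv (fun y => y ^ 2 * piF y)) x
        = deriv (fun y => (R0 + R1 * y) * (R2 - y) * piF y) x := by
  intro x hx
  have hν' : ν ≠ 0 := hν.ne'
  have hsq : ∀ y : ℝ, 0 < y → y ^ 2 * piF y = y ^ (ξ + 1) *
      Real.exp (-(2 * R0 * R2 / ν ^ 2) * (1 / y) - (2 * R1 / ν ^ 2) * y) := by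
    intro y hy
    rw [hpi y hy, ← mul_assoc, ← Real.rpow_natCast y 2, ← Real.rpow_add hy]
    congr 2
    push_cast
    ring
  have hflux : ∀ y : ℝ, 0 < y → deriv (fun z => z ^ 2 * piF z) y
      = 2 / ν ^ 2 * ((R0 + R1 * y) * (R2 - y) * piF y) := by
    intro y hy
    have hy' : y ≠ 0 := hy.ne'
    have heq : (fun z => z ^ 2 * piF z) =ᶠ[nhds y] fun z => z ^ (ξ + 1) *
        Real.exp (-(2 * R0 * R2 / ν ^ 2) * (1 / z) - (2 * R1 / ν ^ 2) * z) := by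
      filter_upwards [lt_mem_nhds hy] with z hz using hsq z hz
    rw [heq.deriv_eq, (hasDerivAt_rpow_mul_exp _ _ _ hy).deriv, ← hsq y hy, hξ]
    field_simp
    ring
  have heq : deriv (fun y => y ^ 2 * piF y) =ᶠ[nhds x]
      fun y => 2 / ν ^ 2 * ((R0 + R1 * y) * (R2 - y) * piF y) := by
    filter_upwards [lt_mem_nhds hx] with y hy using hflux y hy
  rw [heq.deriv_eq, deriv_const_mul_field]
  field_simp
end

section
/- If R0 > 0 (and R1 ≥ 0, R2 > 0, ν > 0), then the function π is integrable on the interval (0, ∞). -/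
open MeasureTheory Set in
theorem integrableOn_rpow_mul_exp_neg_mul_inv {s a : ℝ} (hs : s < -1) (ha : 0 < a) :
    IntegrableOn (fun x : ℝ => x ^ s * Real.exp (-a * x⁻¹)) (Ioi 0) := by
  have h := integrableOn_rpow_mul_exp_neg_mul_rpow (p := 1) (s := -s - 2)
    (by linarith) one_pos ha
  rw [← integrableOn_Ioi_comp_rpow_iff' _ (show (-1 : ℝ) ≠ 0 by norm_num)] at h
  refine h.congr_fun (fun x hx => ?_) measurableSet_Ioi
  have hx : 0 < x := hx
  simp only [smul_eq_mul, Real.rpow_one]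
  rw [← Real.rpow_mul hx.le, ← mul_assoc, ← Real.rpow_add hx, Real.rpow_neg_one]
  ring_nf

open MeasureTheory Set in
theorem integrableOn_rpow_mul_exp_neg_mul_inv_sub_mul {s a b : ℝ} (ha : 0 < a) (hb : 0 ≤ b)
    (h : s < -1 ∨ 0 < b) :
    IntegrableOn (fun x : ℝ => x ^ s * Real.exp (-a * x⁻¹ - b * x)) (Ioi 0) := by
  have hm : AEStronglyMeasurable (fun x : ℝ => x ^ s * Real.exp (-a * x⁻¹ - b * x))
      (volume.restrict (Ioi 0)) := Measurable.aestronglyMeasurable (by fun_prop)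
  rcases h with hs | hb'
  · refine (integrableOn_rpow_mul_exp_neg_mul_inv hs ha).mono' hm ?_
    filter_upwards [ae_restrict_mem measurableSet_Ioi] with x hx
    have hx : 0 < x := hx
    rw [Real.norm_of_nonneg (by positivity)]
    gcongr
    nlinarith [mul_nonneg hb hx.le]
  · have h₀ := integrableOn_rpow_mul_exp_neg_mul_inv (s := min s (-2))
      ((min_le_right _ _).trans_lt (by norm_num)) ha
    have h₁ := integrableOn_rpow_mul_exp_neg_mul_rpow (p := 1) (s := max s 0)
      (lt_of_lt_of_le (by norm_num) (le_max_right _ _)) one_pos hb'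
    refine (h₀.add h₁).mono' hm ?_
    filter_upwards [ae_restrict_mem measurableSet_Ioi] with x hx
    have hx : 0 < x := hx
    have hbx : 0 ≤ b * x := by positivity
    have hax : 0 ≤ a * x⁻¹ := by positivity
    rw [Real.norm_of_nonneg (by positivity)]
    simp only [Pi.add_apply, Real.rpow_one]
    rcases le_total x 1 with hx1 | hx1
    · refine le_add_of_le_of_nonneg ?_ (by positivity)
      refine mul_le_mul (Real.rpow_le_rpow_of_exponent_ge hx hx1 (min_le_left _ _))
        (Real.exp_le_exp.2 (by linarith)) (by positivity) (by positivity)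
    · refine le_add_of_nonneg_of_le (by positivity) ?_
      refine mul_le_mul (Real.rpow_le_rpow_of_exponent_le hx1 (le_max_left _ _))
        (Real.exp_le_exp.2 (by linarith)) (by positivity) (by positivity)


/-- If `R0 > 0` (and `R1 ≥ 0`, `R2 > 0`, `ν > 0`), then the unnormalized GIG steady-state
density `π(x) = x^(ξ-1) * exp(-(2R0R2/ν²)/x - (2R1/ν²)x)` with
`ξ = -2(R0 - R1 R2)/ν² - 1` is integrable on `(0, ∞)`. -/
theorem stmt_1 (R0 R1 R2 ν : ℝ) (hR0 : 0 < R0) (hR1 : 0 ≤ R1) (hR2 : 0 < R2) (hν : 0 < ν)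
    (ξ : ℝ) (hξ : ξ = -2 * (R0 - R1 * R2) / ν ^ 2 - 1) :
    MeasureTheory.IntegrableOn
      (fun x : ℝ => x ^ (ξ - 1) *
        Real.exp (-(2 * R0 * R2 / ν ^ 2) * (1 / x) - (2 * R1 / ν ^ 2) * x))
      (Set.Ioi 0) := by
  simp only [one_div]
  refine integrableOn_rpow_mul_exp_neg_mul_inv_sub_mul (by positivity) (by positivity) ?_
  rcases hR1.eq_or_lt with rfl | hR1
  · left
    have : 0 < 2 * R0 / ν ^ 2 := by positivity
    have : ξ = -(2 * R0 / ν ^ 2) - 1 := by rw [hξ]; ring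
    linarith
  · right
    positivity
end

section
/- If R0 > 0, R1 > 0, R2 > 0 and ν > 0, then the normalized first moment μ = (∫₀^∞ x·π(x) dx)/(∫₀^∞ π(x) dx) of the GIG steady-state density satisfies the lower bound μ ≥ (1/2)·( ξ/b + sqrt( ξ²/b² + 4·a/b ) ), where a = 2·R0·R2/ν² and b = 2·R1/ν². -/
open Set Filter Topology MeasureTheory

/-- The unnormalized generalized inverse Gaussian kernel `x ^ s * exp (-a / x - b x)`. -/
noncomputable def gigKernel (a b s x : ℝ) : ℝ := x ^ s * Real.exp (-a * (1 / x) - b * x)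

lemma gigKernel_pos (a b s : ℝ) {x : ℝ} (hx : 0 < x) : 0 < gigKernel a b s x :=
  mul_pos (Real.rpow_pos_of_pos hx s) (Real.exp_pos _)

lemma mul_gigKernel (a b s : ℝ) {x : ℝ} (hx : 0 < x) :
    x * gigKernel a b s x = gigKernel a b (s + 1) x := by
  rw [gigKernel, gigKernel, Real.rpow_add hx, Real.rpow_one]
  ring

lemma exists_gigKernel_le {a : ℝ} (ha : 0 < a) (b s : ℝ) :
    ∃ C t : ℝ, 0 < t ∧ ∀ x : ℝ, 0 < x →
      gigKernel a b s x ≤ C * (x ^ t * Real.exp (-b * x)) := by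
  obtain ⟨n, hn⟩ := exists_nat_gt (-s)
  refine ⟨n.factorial / a ^ n, s + n, by linarith, fun x hx ↦ ?_⟩
  have h := Real.pow_div_factorial_le_exp (x := a / x) (by positivity) n
  have hexp : Real.exp (-(a / x)) ≤ n.factorial / a ^ n * x ^ n := by
    rw [Real.exp_neg]
    refine (inv_anti₀ (by positivity) h).trans_eq ?_
    rw [div_pow]
    field_simp
  have hsplit : Real.exp (-a * (1 / x) - b * x) = Real.exp (-(a / x)) * Real.exp (-b * x) := by
    rw [← Real.exp_add]
    ring_nf
  rw [gigKernel, hsplit, Real.rpow_add hx, Real.rpow_natCast]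
  calc x ^ s * (Real.exp (-(a / x)) * Real.exp (-b * x))
      ≤ x ^ s * (n.factorial / a ^ n * x ^ n * Real.exp (-b * x)) := by gcongr
    _ = n.factorial / a ^ n * (x ^ s * x ^ n * Real.exp (-b * x)) := by ring

lemma integrableOn_gigKernel {a b : ℝ} (ha : 0 < a) (hb : 0 < b) (s : ℝ) :
    IntegrableOn (gigKernel a b s) (Ioi 0) := by
  obtain ⟨C, t, ht, hC⟩ := exists_gigKernel_le ha b s
  have hint : IntegrableOn (fun x : ℝ ↦ C * (x ^ t * Real.exp (-b * x))) (Ioi 0) := by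
    have := integrableOn_rpow_mul_exp_neg_mul_rpow (s := t) (p := 1) (by linarith) one_pos hb
    simp only [Real.rpow_one] at this
    exact this.const_mul C
  refine Integrable.mono' hint ?_ ?_
  · apply Measurable.aestronglyMeasurable
    unfold gigKernel
    fun_prop
  · filter_upwards [ae_restrict_mem measurableSet_Ioi] with x hx
    rw [Real.norm_of_nonneg (gigKernel_pos a b s hx).le]
    exact hC x hx

lemma integral_gigKernel_pos {a b : ℝ} (ha : 0 < a) (hb : 0 < b) (s : ℝ) :
    0 < ∫ x in Ioi 0, gigKernel a b s x := by
  rw [setIntegral_pos_iff_support_of_nonneg_ae _ (integrableOn_gigKernel ha hb s)]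
  · have : Function.support (gigKernel a b s) ∩ Ioi 0 = Ioi 0 :=
      inter_eq_right.2 fun x hx ↦ (gigKernel_pos a b s hx).ne'
    simp [this]
  · filter_upwards [ae_restrict_mem measurableSet_Ioi] with x hx
    exact (gigKernel_pos a b s hx).le

lemma tendsto_gigKernel_nhdsGT_zero {a : ℝ} (ha : 0 < a) (b s : ℝ) :
    Tendsto (gigKernel a b s) (𝓝[>] 0) (𝓝 0) := by
  obtain ⟨C, t, ht, hC⟩ := exists_gigKernel_le ha b s
  have hcont : Continuous fun x : ℝ ↦ C * (x ^ t * Real.exp (-b * x)) := by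
    have := Real.continuous_rpow_const ht.le
    fun_prop
  have hlim := (hcont.tendsto 0).mono_left (nhdsWithin_le_nhds (s := Ioi 0))
  simp only [Real.zero_rpow ht.ne', zero_mul, mul_zero] at hlim
  refine tendsto_of_tendsto_of_tendsto_of_le_of_le' tendsto_const_nhds hlim ?_ ?_
  · filter_upwards [self_mem_nhdsWithin] with x hx using (gigKernel_pos a b s hx).le
  · filter_upwards [self_mem_nhdsWithin] with x hx using hC x hx

lemma tendsto_gigKernel_atTop {a b : ℝ} (ha : 0 < a) (hb : 0 < b) (s : ℝ) :
    Tendsto (gigKernel a b s) atTop (𝓝 0) := by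
  obtain ⟨C, t, -, hC⟩ := exists_gigKernel_le ha b s
  have hlim := (tendsto_rpow_mul_exp_neg_mul_atTop_nhds_zero t b hb).const_mul C
  rw [mul_zero] at hlim
  refine tendsto_of_tendsto_of_tendsto_of_le_of_le' tendsto_const_nhds hlim ?_ ?_
  · filter_upwards [eventually_gt_atTop 0] with x hx using (gigKernel_pos a b s hx).le
  · filter_upwards [eventually_gt_atTop 0] with x hx using hC x hx

/-- The three-term recurrence between consecutive moments, from integrating the derivative of
`gigKernel a b s`. -/
lemma integral_gigKernel_recurrence {a b : ℝ} (ha : 0 < a) (hb : 0 < b) (s : ℝ) :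
    s * (∫ x in Ioi 0, gigKernel a b (s - 1) x) + a * (∫ x in Ioi 0, gigKernel a b (s - 2) x)
      = b * ∫ x in Ioi 0, gigKernel a b s x := by
  set u : ℝ → ℝ := fun x ↦ x ^ s
  set v : ℝ → ℝ := fun x ↦ Real.exp (-a * (1 / x) - b * x)
  set u' : ℝ → ℝ := fun x ↦ s * x ^ (s - 1)
  set v' : ℝ → ℝ := fun x ↦ Real.exp (-a * (1 / x) - b * x) * (a / x ^ 2 - b)
  have hu : ∀ x ∈ Ioi (0 : ℝ), HasDerivAt u (u' x) x := fun x hx ↦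
    Real.hasDerivAt_rpow_const (Or.inl (ne_of_gt hx))
  have hv : ∀ x ∈ Ioi (0 : ℝ), HasDerivAt v (v' x) x := fun x hx ↦ by
    have hinv := (hasDerivAt_inv (ne_of_gt hx : x ≠ 0)).const_mul (-a)
    have hlin := (hasDerivAt_id x).const_mul b
    refine HasDerivAt.exp ?_
    convert! hinv.sub hlin using 1
    · ext y
      simp
    · field_simp
  have I0 := (integrableOn_gigKernel ha hb (s - 1)).const_mul s
  have I1 := (integrableOn_gigKernel ha hb (s - 2)).const_mul a
  have I2 := (integrableOn_gigKernel ha hb s).const_mul b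
  have I01 : Integrable (fun x ↦ s * gigKernel a b (s - 1) x + a * gigKernel a b (s - 2) x)
      (volume.restrict (Ioi 0)) := I0.add I1
  have hder : EqOn (fun x ↦ s * gigKernel a b (s - 1) x + a * gigKernel a b (s - 2) x
      - b * gigKernel a b s x) (fun x ↦ u' x * v x + u x * v' x) (Ioi 0) := fun x hx ↦ by
    have h2 : x ^ (s - 2) = x ^ s / x ^ 2 := by
      rw [Real.rpow_sub hx, Real.rpow_two]
    simp only [gigKernel, u, v, u', v', h2]
    ring
  have hint := integral_Ioi_deriv_mul_eq_sub hu hv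
    (IntegrableOn.congr_fun (I01.sub I2) hder measurableSet_Ioi)
    (tendsto_gigKernel_nhdsGT_zero ha b s) (tendsto_gigKernel_atTop ha hb s)
  rw [← setIntegral_congr_fun measurableSet_Ioi hder, integral_sub I01 I2,
    integral_add I0 I1, integral_const_mul, integral_const_mul, integral_const_mul] at hint
  linarith

lemma integral_gigKernel_quadratic_nonneg {a b : ℝ} (ha : 0 < a) (hb : 0 < b) (s m : ℝ) :
    0 ≤ (∫ x in Ioi 0, gigKernel a b s x) - 2 * m * (∫ x in Ioi 0, gigKernel a b (s - 1) x)
      + m ^ 2 * ∫ x in Ioi 0, gigKernel a b (s - 2) x := by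
  have I0 := integrableOn_gigKernel ha hb s
  have I1 := (integrableOn_gigKernel ha hb (s - 1)).const_mul (2 * m)
  have I2 := (integrableOn_gigKernel ha hb (s - 2)).const_mul (m ^ 2)
  have I01 : Integrable (fun x ↦ gigKernel a b s x - 2 * m * gigKernel a b (s - 1) x)
      (volume.restrict (Ioi 0)) := I0.sub I1
  rw [← integral_const_mul, ← integral_const_mul, ← integral_sub I0 I1, ← integral_add I01 I2]
  refine setIntegral_nonneg measurableSet_Ioi fun x hx ↦ ?_
  have h1 := mul_gigKernel a b (s - 2) hx
  have h2 := mul_gigKernel a b (s - 1) hx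
  rw [show s - 2 + 1 = s - 1 by ring] at h1
  rw [sub_add_cancel] at h2
  rw [← h2, ← h1]
  have := mul_nonneg (sq_nonneg (x - m)) (gigKernel_pos a b (s - 2) hx).le
  linarith

/-- A positive `μ` at which `b X ^ 2 - ξ X - a` is nonnegative lies above its positive root. -/
lemma quadratic_root_le {a b ξ μ : ℝ} (ha : 0 < a) (hb : 0 < b) (hμ : 0 < μ)
    (h : 0 ≤ b * μ ^ 2 - ξ * μ - a) :
    (1 / 2) * (ξ / b + Real.sqrt (ξ ^ 2 / b ^ 2 + 4 * a / b)) ≤ μ := by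
  have hlt : ξ < b * μ := by
    by_contra! hle
    nlinarith [mul_le_mul_of_nonneg_right hle hμ.le]
  have hdiv : ξ / b < μ := by
    rw [div_lt_iff₀ hb]
    linarith
  have hsqrt : Real.sqrt (ξ ^ 2 / b ^ 2 + 4 * a / b) ≤ 2 * μ - ξ / b := by
    refine Real.sqrt_le_iff.2 ⟨by linarith, ?_⟩
    have hq : 0 ≤ (b * μ ^ 2 - ξ * μ - a) / b := by positivity
    have heq : (2 * μ - ξ / b) ^ 2 - (ξ ^ 2 / b ^ 2 + 4 * a / b)
        = 4 * ((b * μ ^ 2 - ξ * μ - a) / b) := by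
      field_simp
      ring
    linarith
  linarith


/-- For `R0, R1, R2, ν > 0`, the normalized first moment
`μ = (∫₀^∞ x π(x) dx)/(∫₀^∞ π(x) dx)` of the GIG steady-state density
`π(x) = x^(ξ-1) * exp(-a/x - b x)`, with `a = 2R0R2/ν²` and `b = 2R1/ν²`, satisfies
`μ ≥ (1/2)(ξ/b + sqrt(ξ²/b² + 4a/b))`. -/
theorem stmt_8 (R0 R1 R2 ν : ℝ) (hR0 : 0 < R0) (hR1 : 0 < R1) (hR2 : 0 < R2) (hν : 0 < ν)
    (ξ a b : ℝ) (hξ : ξ = -2 * (R0 - R1 * R2) / ν ^ 2 - 1)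
    (ha : a = 2 * R0 * R2 / ν ^ 2) (hb : b = 2 * R1 / ν ^ 2)
    (piF : ℝ → ℝ)
    (hpi : ∀ x : ℝ, piF x = x ^ (ξ - 1) * Real.exp (-a * (1 / x) - b * x))
    (μ : ℝ)
    (hμ : μ = (∫ x in Set.Ioi (0 : ℝ), x * piF x) / (∫ x in Set.Ioi (0 : ℝ), piF x)) :
    μ ≥ (1 / 2) * (ξ / b + Real.sqrt (ξ ^ 2 / b ^ 2 + 4 * a / b)) := by
  have ha0 : 0 < a := by rw [ha]; positivity
  have hb0 : 0 < b := by rw [hb]; positivity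
  have hnum : ∫ x in Set.Ioi (0 : ℝ), x * piF x = ∫ x in Set.Ioi 0, gigKernel a b ξ x := by
    refine setIntegral_congr_fun measurableSet_Ioi fun x hx ↦ ?_
    simpa [gigKernel, hpi] using mul_gigKernel a b (ξ - 1) hx
  have hden : ∫ x in Set.Ioi (0 : ℝ), piF x = ∫ x in Set.Ioi 0, gigKernel a b (ξ - 1) x :=
    congrArg _ (funext hpi)
  rw [hnum, hden] at hμ
  have hM0 := integral_gigKernel_pos ha0 hb0 (ξ - 1)
  have hμ0 : 0 < μ := hμ ▸ div_pos (integral_gigKernel_pos ha0 hb0 ξ) hM0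
  have hrec := integral_gigKernel_recurrence ha0 hb0 ξ
  have hquad := integral_gigKernel_quadratic_nonneg ha0 hb0 ξ μ
  rw [eq_div_iff hM0.ne'] at hμ
  rw [← hμ] at hrec hquad
  generalize (∫ x in Set.Ioi 0, gigKernel a b (ξ - 1) x) = M at hM0 hrec hquad
  generalize (∫ x in Set.Ioi 0, gigKernel a b (ξ - 2) x) = N at hrec hquad
  have hN : M ≤ μ * N := by
    refine le_of_mul_le_mul_left ?_ hμ0
    linarith
  refine quadratic_root_le ha0 hb0 hμ0 (nonneg_of_mul_nonneg_left ?_ hM0)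
  have heq : (b * μ ^ 2 - ξ * μ - a) * M = a * (μ * N - M) := by
    linear_combination -μ * hrec
  rw [heq]
  exact mul_nonneg ha0.le (sub_nonneg.2 hN)
end

section
/- Let ν > 0, R1 ≥ 0, ρ ∈ (−1, 1) with R1 ≥ ρ·ν. Define m₊ = (1 − 2·(R1/ν)·ρ + sqrt((1 − 2·(R1/ν)·ρ)² + 4·(1 − ρ²)·R1²/ν²)) / (2·(1 − ρ²)) and m₋ = (1 − 2·(R1/ν)·ρ − sqrt((1 − 2·(R1/ν)·ρ)² + 4·(1 − ρ²)·R1²/ν²)) / (2·(1 − ρ²)). Then m₋ ≤ 0 ≤ 1 ≤ m₊, and m₊ is the unique m ∈ [1, ∞) satisfying ρ·m + sqrt(m² − m) = R1/ν, while m₋ is the unique m ∈ (−∞, 0] satisfying ρ·m + sqrt(m² − m) = R1/ν. -/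
/-- For `ν > 0`, `R1 ≥ 0`, `ρ ∈ (-1, 1)` with `R1 ≥ ρν`, the critical moments
`m₊` and `m₋` given by the explicit quadratic-root formulas satisfy `m₋ ≤ 0 ≤ 1 ≤ m₊`,
and `m₊` (resp. `m₋`) is the unique solution in `[1, ∞)` (resp. `(-∞, 0]`) of
`ρ m + sqrt(m² - m) = R1/ν`. -/
theorem stmt_9 (ν R1 ρ : ℝ) (hν : 0 < ν) (hR1 : 0 ≤ R1) (hρ1 : -1 < ρ) (hρ2 : ρ < 1)
    (hcorr : ρ * ν ≤ R1)
    (mp mm : ℝ)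
    (hmp : mp = (1 - 2 * (R1 / ν) * ρ +
        Real.sqrt ((1 - 2 * (R1 / ν) * ρ) ^ 2 + 4 * (1 - ρ ^ 2) * R1 ^ 2 / ν ^ 2)) /
      (2 * (1 - ρ ^ 2)))
    (hmm : mm = (1 - 2 * (R1 / ν) * ρ -
        Real.sqrt ((1 - 2 * (R1 / ν) * ρ) ^ 2 + 4 * (1 - ρ ^ 2) * R1 ^ 2 / ν ^ 2)) /
      (2 * (1 - ρ ^ 2))) :
    mm ≤ 0 ∧ 1 ≤ mp ∧
    ρ * mp + Real.sqrt (mp ^ 2 - mp) = R1 / ν ∧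
    (∀ m : ℝ, 1 ≤ m → ρ * m + Real.sqrt (m ^ 2 - m) = R1 / ν → m = mp) ∧
    ρ * mm + Real.sqrt (mm ^ 2 - mm) = R1 / ν ∧
    (∀ m : ℝ, m ≤ 0 → ρ * m + Real.sqrt (m ^ 2 - m) = R1 / ν → m = mm) := by
  have hk : 0 ≤ R1 / ν := by positivity
  have hkρ : ρ ≤ R1 / ν := (le_div_iff₀ hν).2 hcorr
  rw [mul_div_assoc, ← div_pow] at hmp hmm
  generalize R1 / ν = k at *
  have ha : 0 < 1 - ρ ^ 2 := by nlinarith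
  have hD : 0 ≤ (1 - 2 * k * ρ) ^ 2 + 4 * (1 - ρ ^ 2) * k ^ 2 := by positivity
  have hS := Real.sq_sqrt hD
  have hbS : 1 - 2 * k * ρ ≤ √((1 - 2 * k * ρ) ^ 2 + 4 * (1 - ρ ^ 2) * k ^ 2) := by
    apply Real.le_sqrt_of_sq_le
    have : 0 ≤ 4 * (1 - ρ ^ 2) * k ^ 2 := by positivity
    linarith
  generalize √((1 - 2 * k * ρ) ^ 2 + 4 * (1 - ρ ^ 2) * k ^ 2) = S at *
  have hfac : ∀ x : ℝ, (1 - ρ ^ 2) * ((x - mp) * (x - mm)) = x ^ 2 - x - (k - ρ * x) ^ 2 := by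
    intro x
    have hsum : (1 - ρ ^ 2) * (mp + mm) = 1 - 2 * k * ρ := by
      rw [hmp, hmm]
      field_simp
      ring
    have hprod : (1 - ρ ^ 2) * (mp * mm) = -k ^ 2 := by
      rw [hmp, hmm]
      field_simp
      linear_combination -hS
    linear_combination -x * hsum + hprod
  have hmm0 : mm ≤ 0 := by
    rw [hmm]
    exact div_nonpos_of_nonpos_of_nonneg (by linarith) (by linarith)
  have hmp1 : 1 ≤ mp := by
    by_contra! h
    have h1 : 0 < (1 - ρ ^ 2) * ((1 - mp) * (1 - mm)) :=
      mul_pos ha (mul_pos (by linarith) (by linarith))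
    rw [hfac 1] at h1
    nlinarith [sq_nonneg (k - ρ * 1)]
  have hline : (1 - ρ ^ 2) * ((k - ρ * mp) * (k - ρ * mm)) = k * (k - ρ) := by
    by_cases hρ : ρ = 0
    · subst hρ
      ring
    · have h := hfac (k / ρ)
      field_simp at h
      linear_combination h
  have hline0 : 0 ≤ (k - ρ * mp) * (k - ρ * mm) :=
    nonneg_of_mul_nonneg_right (hline ▸ mul_nonneg hk (by linarith)) ha
  have hkp : 0 ≤ k - ρ * mp := by
    rcases le_or_gt ρ 0 with hρ | hρ
    · nlinarith
    · exact nonneg_of_mul_nonneg_left hline0 (by nlinarith)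
  have hkm : 0 ≤ k - ρ * mm := by
    rcases le_or_gt 0 ρ with hρ | hρ
    · nlinarith
    · exact nonneg_of_mul_nonneg_right hline0 (by nlinarith)
  have hsol : ∀ x : ℝ, (x - mp) * (x - mm) = 0 → 0 ≤ k - ρ * x →
      ρ * x + √(x ^ 2 - x) = k := by
    intro x hx hx0
    have h := hfac x
    rw [hx] at h
    rw [show x ^ 2 - x = (k - ρ * x) ^ 2 by linarith, Real.sqrt_sq hx0]
    ring
  have hroot : ∀ x : ℝ, 0 ≤ x ^ 2 - x → ρ * x + √(x ^ 2 - x) = k → x = mp ∨ x = mm := by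
    intro x hx h
    have hs := Real.sq_sqrt hx
    rw [show √(x ^ 2 - x) = k - ρ * x by linarith] at hs
    have h0 : (1 - ρ ^ 2) * ((x - mp) * (x - mm)) = 0 := by rw [hfac]; linarith
    rcases mul_eq_zero.1 ((mul_eq_zero.1 h0).resolve_left ha.ne') with h | h
    · exact Or.inl (sub_eq_zero.1 h)
    · exact Or.inr (sub_eq_zero.1 h)
  refine ⟨hmm0, hmp1, hsol mp (by ring) hkp, fun m hm h => ?_, hsol mm (by ring) hkm,
    fun m hm h => ?_⟩
  · exact (hroot m (by nlinarith) h).resolve_right (by intro h'; linarith)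
  · exact (hroot m (by nlinarith) h).resolve_left (by intro h'; linarith)
end

section
/- Let R0, R1, R2, ρ, ν be real numbers with ν ≠ 0 and set z = R1/ν. Define the linear operator 𝒢 on the polynomial ring ℝ[X, Y, S] (variables x, y, s) by 𝒢p = (z·ρ − 1/2)·s²·∂p/∂x + (1/2)·z²·s²·∂p/∂y + (R0·R2 + (R1·R2 − R0)·s)·∂p/∂s + (1/2)·s²·∂²p/∂x² + (1/2)·z²·s²·∂²p/∂y² + (1/2)·ν²·s²·∂²p/∂s² + z·ρ·s²·∂²p/∂x∂y + ν·ρ·s²·∂²p/∂x∂s + z·ν·s²·∂²p/∂y∂s. Then for every natural number m, 𝒢 maps the subspace P_m into itself. -/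
open MvPolynomial

/-- The subspace `P_m` of `ℝ[X, Y, S]` spanned by the monomials `X^α Y^β S^γ` with
`α + β ≤ m` and `γ ≤ 2(m - α - β)`. The variables are `X 0 = x`, `X 1 = y`, `X 2 = s`. -/
noncomputable def polySubspace (m : ℕ) : Submodule ℝ (MvPolynomial (Fin 3) ℝ) :=
  Submodule.span ℝ
    {p : MvPolynomial (Fin 3) ℝ | ∃ α β γ : ℕ, α + β ≤ m ∧ γ ≤ 2 * (m - α - β) ∧
      p = X 0 ^ α * X 1 ^ β * X 2 ^ γ}

/-- The infinitesimal generator `𝒢` of `(x_t, y_t, σ_t)` under `ℚ^z`, acting on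
polynomials in the variables `x = X 0`, `y = X 1`, `s = X 2`, with `z = R1/ν`:
`𝒢p = (zρ - 1/2) s² p_x + (1/2) z² s² p_y + (R0R2 + (R1R2 - R0)s) p_s + (1/2) s² p_xx
  + (1/2) z² s² p_yy + (1/2) ν² s² p_ss + zρ s² p_xy + νρ s² p_xs + zν s² p_ys`. -/
noncomputable def generatorG (R0 R1 R2 ρ ν : ℝ) (p : MvPolynomial (Fin 3) ℝ) :
    MvPolynomial (Fin 3) ℝ :=
  let z := R1 / ν
  C (z * ρ - 1 / 2) * X 2 ^ 2 * pderiv 0 p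
    + C ((1 / 2) * z ^ 2) * X 2 ^ 2 * pderiv 1 p
    + (C (R0 * R2) + C (R1 * R2 - R0) * X 2) * pderiv 2 p
    + C (1 / 2) * X 2 ^ 2 * pderiv 0 (pderiv 0 p)
    + C ((1 / 2) * z ^ 2) * X 2 ^ 2 * pderiv 1 (pderiv 1 p)
    + C ((1 / 2) * ν ^ 2) * X 2 ^ 2 * pderiv 2 (pderiv 2 p)
    + C (z * ρ) * X 2 ^ 2 * pderiv 1 (pderiv 0 p)
    + C (ν * ρ) * X 2 ^ 2 * pderiv 2 (pderiv 0 p)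
    + C (z * ν) * X 2 ^ 2 * pderiv 2 (pderiv 1 p)

theorem pderiv_pderiv_comm {R σ : Type*} [CommRing R] (i j : σ) (p : MvPolynomial σ R) :
    pderiv i (pderiv j p) = pderiv j (pderiv i p) := by
  classical
  have h : ⁅pderiv (R := R) i, pderiv (R := R) j⁆ = 0 := by
    refine derivation_ext fun k => ?_
    rw [Derivation.commutator_apply, pderiv_X, pderiv_X, Pi.single_apply, Pi.single_apply]
    split_ifs <;> simp
  rw [← sub_eq_zero, ← Derivation.commutator_apply, h, Derivation.zero_apply]

theorem C_mul_monomial_mem_polySubspace {m α β γ : ℕ} (h : 2 * α + 2 * β + γ ≤ 2 * m) (c : ℝ) :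
    C c * (X 0 ^ α * X 1 ^ β * X 2 ^ γ) ∈ polySubspace m := by
  rw [← smul_eq_C_mul]
  exact Submodule.smul_mem _ _ (Submodule.subset_span ⟨α, β, γ, by lia, by lia, rfl⟩)

theorem C_mul_mem_polySubspace {m : ℕ} {p : MvPolynomial (Fin 3) ℝ} (hp : p ∈ polySubspace m)
    (c : ℝ) : C c * p ∈ polySubspace m := by
  rw [← smul_eq_C_mul]
  exact Submodule.smul_mem _ _ hp

theorem map_mem_polySubspace {m : ℕ} (L : MvPolynomial (Fin 3) ℝ →ₗ[ℝ] MvPolynomial (Fin 3) ℝ)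
    (hL : ∀ α β γ : ℕ, 2 * α + 2 * β + γ ≤ 2 * m →
      L (X 0 ^ α * X 1 ^ β * X 2 ^ γ) ∈ polySubspace m)
    {p : MvPolynomial (Fin 3) ℝ} (hp : p ∈ polySubspace m) : L p ∈ polySubspace m := by
  have h : polySubspace m ≤ (polySubspace m).comap L := by
    refine Submodule.span_le.2 ?_
    rintro _ ⟨α, β, γ, h₁, h₂, rfl⟩
    exact hL α β γ (by lia)
  exact h hp

theorem pderiv_zero_monomial (α β γ : ℕ) :
    pderiv 0 (X 0 ^ α * X 1 ^ β * X 2 ^ γ : MvPolynomial (Fin 3) ℝ) =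
      C (α : ℝ) * (X 0 ^ (α - 1) * X 1 ^ β * X 2 ^ γ) := by
  simp [Derivation.leibniz, Derivation.leibniz_pow, pderiv_X]
  ring

theorem pderiv_one_monomial (α β γ : ℕ) :
    pderiv 1 (X 0 ^ α * X 1 ^ β * X 2 ^ γ : MvPolynomial (Fin 3) ℝ) =
      C (β : ℝ) * (X 0 ^ α * X 1 ^ (β - 1) * X 2 ^ γ) := by
  simp [Derivation.leibniz, Derivation.leibniz_pow, pderiv_X]
  ring

theorem pderiv_two_monomial (α β γ : ℕ) :
    pderiv 2 (X 0 ^ α * X 1 ^ β * X 2 ^ γ : MvPolynomial (Fin 3) ℝ) =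
      C (γ : ℝ) * (X 0 ^ α * X 1 ^ β * X 2 ^ (γ - 1)) := by
  simp [Derivation.leibniz, Derivation.leibniz_pow, pderiv_X]
  ring

section

variable {m : ℕ} {p : MvPolynomial (Fin 3) ℝ}

theorem pderiv_mem_polySubspace (i : Fin 3) (hp : p ∈ polySubspace m) :
    pderiv i p ∈ polySubspace m := by
  refine map_mem_polySubspace (pderiv i).toLinearMap (fun α β γ h => ?_) hp
  fin_cases i
  · exact (pderiv_zero_monomial α β γ).symm ▸ C_mul_monomial_mem_polySubspace (by lia) _
  · exact (pderiv_one_monomial α β γ).symm ▸ C_mul_monomial_mem_polySubspace (by lia) _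
  · exact (pderiv_two_monomial α β γ).symm ▸ C_mul_monomial_mem_polySubspace (by lia) _

theorem X_two_sq_mul_pderiv_zero_mem_polySubspace (hp : p ∈ polySubspace m) :
    X 2 ^ 2 * pderiv 0 p ∈ polySubspace m := by
  refine map_mem_polySubspace (LinearMap.mulLeft ℝ (X 2 ^ 2) ∘ₗ (pderiv 0).toLinearMap)
    (fun α β γ h => ?_) hp
  change X 2 ^ 2 * pderiv 0 (X 0 ^ α * X 1 ^ β * X 2 ^ γ) ∈ polySubspace m
  rw [pderiv_zero_monomial]
  rcases α with _ | α
  · simp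
  · convert C_mul_monomial_mem_polySubspace (m := m) (α := α) (β := β) (γ := γ + 2) (by lia)
      ((α + 1 : ℕ) : ℝ) using 1
    rw [Nat.add_sub_cancel]
    ring

theorem X_two_sq_mul_pderiv_one_mem_polySubspace (hp : p ∈ polySubspace m) :
    X 2 ^ 2 * pderiv 1 p ∈ polySubspace m := by
  refine map_mem_polySubspace (LinearMap.mulLeft ℝ (X 2 ^ 2) ∘ₗ (pderiv 1).toLinearMap)
    (fun α β γ h => ?_) hp
  change X 2 ^ 2 * pderiv 1 (X 0 ^ α * X 1 ^ β * X 2 ^ γ) ∈ polySubspace m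
  rw [pderiv_one_monomial]
  rcases β with _ | β
  · simp
  · convert C_mul_monomial_mem_polySubspace (m := m) (α := α) (β := β) (γ := γ + 2) (by lia)
      ((β + 1 : ℕ) : ℝ) using 1
    rw [Nat.add_sub_cancel]
    ring

theorem X_two_mul_pderiv_two_mem_polySubspace (hp : p ∈ polySubspace m) :
    X 2 * pderiv 2 p ∈ polySubspace m := by
  refine map_mem_polySubspace (LinearMap.mulLeft ℝ (X 2) ∘ₗ (pderiv 2).toLinearMap)
    (fun α β γ h => ?_) hp
  change X 2 * pderiv 2 (X 0 ^ α * X 1 ^ β * X 2 ^ γ) ∈ polySubspace m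
  rw [pderiv_two_monomial]
  rcases γ with _ | γ
  · simp
  · convert C_mul_monomial_mem_polySubspace (m := m) (α := α) (β := β) (γ := γ + 1) (by lia)
      ((γ + 1 : ℕ) : ℝ) using 1
    rw [Nat.add_sub_cancel]
    ring

theorem X_two_sq_mul_pderiv_two_pderiv_two_mem_polySubspace (hp : p ∈ polySubspace m) :
    X 2 ^ 2 * pderiv 2 (pderiv 2 p) ∈ polySubspace m := by
  have h := X_two_mul_pderiv_two_mem_polySubspace hp
  have key : X 2 ^ 2 * pderiv 2 (pderiv 2 p) =
      X 2 * pderiv 2 (X 2 * pderiv 2 p) - X 2 * pderiv 2 p := by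
    rw [pderiv_mul, pderiv_X_self]
    ring
  rw [key]
  exact Submodule.sub_mem _ (X_two_mul_pderiv_two_mem_polySubspace h) h

end

/-- The generator `𝒢` maps the subspace `P_m` into itself, for every `m`. -/
theorem stmt_16 (R0 R1 R2 ρ ν : ℝ) (hν : ν ≠ 0) (m : ℕ)
    (p : MvPolynomial (Fin 3) ℝ) (hp : p ∈ polySubspace m) :
    generatorG R0 R1 R2 ρ ν p ∈ polySubspace m := by
  have hd (i : Fin 3) := pderiv_mem_polySubspace i hp
  unfold generatorG
  simp only [add_mul, mul_assoc]
  rw [pderiv_pderiv_comm 2 0, pderiv_pderiv_comm 2 1]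
  refine add_mem (add_mem (add_mem (add_mem (add_mem (add_mem (add_mem (add_mem ?_ ?_)
    (add_mem ?_ ?_)) ?_) ?_) ?_) ?_) ?_) ?_ <;> refine C_mul_mem_polySubspace ?_ _
  · exact X_two_sq_mul_pderiv_zero_mem_polySubspace hp
  · exact X_two_sq_mul_pderiv_one_mem_polySubspace hp
  · exact hd 2
  · exact X_two_mul_pderiv_two_mem_polySubspace hp
  · exact X_two_sq_mul_pderiv_zero_mem_polySubspace (hd 0)
  · exact X_two_sq_mul_pderiv_one_mem_polySubspace (hd 1)
  · exact X_two_sq_mul_pderiv_two_pderiv_two_mem_polySubspace hp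
  · exact X_two_sq_mul_pderiv_one_mem_polySubspace (hd 0)
  · exact X_two_sq_mul_pderiv_zero_mem_polySubspace (hd 2)
  · exact X_two_sq_mul_pderiv_one_mem_polySubspace (hd 2)
end

section
/- Let m ∈ ℝ, v > 0 and K > 0, and set ξ = (m − log K)/sqrt(v). Then ∫_ℝ max(e^x − K, 0)·φ_{m,v}(x) dx = e^{m + v/2}·Φ(ξ + sqrt(v)) − K·Φ(ξ), where φ_{m,v}(x) = (2πv)^{−1/2}·exp(−(x − m)²/(2v)) is the Gaussian density with mean m and variance v, and Φ is the standard normal cumulative distribution function Φ(t) = ∫_{−∞}^{t} (2π)^{−1/2}·e^{−u²/2} du. -/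
/-- The Gaussian density with mean `m` and variance `v`:
`φ_{m,v}(x) = (2πv)^(-1/2) exp(-(x - m)²/(2v))`. -/
noncomputable def gaussianDens (m v x : ℝ) : ℝ :=
  (Real.sqrt (2 * Real.pi * v))⁻¹ * Real.exp (-(x - m) ^ 2 / (2 * v))

/-- The standard normal cumulative distribution function
`Φ(t) = ∫_{-∞}^t (2π)^(-1/2) e^(-u²/2) du`. -/
noncomputable def stdNormalCDF (t : ℝ) : ℝ :=
  ∫ u in Set.Iic t, (Real.sqrt (2 * Real.pi))⁻¹ * Real.exp (-u ^ 2 / 2)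

open MeasureTheory

theorem integrable_gaussianDens (m : ℝ) {v : ℝ} (hv : 0 < v) : Integrable (gaussianDens m v) :=
  ProbabilityTheory.integrable_gaussianPDFReal m ⟨v, hv.le⟩

/-- Exponential tilting shifts the mean of a Gaussian density by its variance. -/
theorem exp_mul_gaussianDens (m : ℝ) {v : ℝ} (hv : 0 < v) (x : ℝ) :
    Real.exp x * gaussianDens m v x = Real.exp (m + v / 2) * gaussianDens (m + v) v x := by
  unfold gaussianDens
  rw [mul_left_comm, ← Real.exp_add, mul_left_comm, ← Real.exp_add]
  congr 2
  field_simp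
  ring

/-- The upper tail of a Gaussian density in terms of the standard normal distribution function. -/
theorem setIntegral_Ioi_gaussianDens (m a : ℝ) {v : ℝ} (hv : 0 < v) :
    ∫ x in Set.Ioi a, gaussianDens m v x = stdNormalCDF ((m - a) / Real.sqrt v) := by
  have hs : 0 < Real.sqrt v := Real.sqrt_pos.2 hv
  have hsq : Real.sqrt v ^ 2 = v := Real.sq_sqrt hv.le
  have hsubst := Measure.integral_comp_mul_left
    (fun y ↦ (Set.Ici a).indicator (gaussianDens m v) (m - y)) (Real.sqrt v)
  rw [integral_sub_left_eq_self (fun y ↦ (Set.Ici a).indicator (gaussianDens m v) y) volume m,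
    integral_indicator measurableSet_Ici, abs_of_pos (inv_pos.2 hs), smul_eq_mul] at hsubst
  rw [← integral_Ici_eq_integral_Ioi, ← mul_inv_cancel_left₀ hs.ne' (∫ x in Set.Ici a, _),
    ← hsubst, ← integral_const_mul, stdNormalCDF, ← integral_indicator measurableSet_Iic]
  congr 1 with u
  have hmem : m - Real.sqrt v * u ∈ Set.Ici a ↔ u ∈ Set.Iic ((m - a) / Real.sqrt v) := by
    rw [Set.mem_Ici, Set.mem_Iic, le_div_iff₀ hs, mul_comm u]
    constructor <;> intro h <;> linarith
  by_cases hu : u ∈ Set.Iic ((m - a) / Real.sqrt v)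
  · rw [Set.indicator_of_mem hu, Set.indicator_of_mem (hmem.2 hu), gaussianDens,
      Real.sqrt_mul (by positivity), mul_inv, ← mul_assoc, mul_comm (Real.sqrt _)⁻¹ (Real.sqrt v)⁻¹,
      mul_inv_cancel_left₀ hs.ne']
    congr 2
    rw [sub_sub_cancel_left, neg_sq, mul_pow, hsq]
    field_simp
  · rw [Set.indicator_of_notMem hu, Set.indicator_of_notMem (mt hmem.1 hu), mul_zero]

/-- Black–Scholes type formula: for `v > 0`, `K > 0` and `ξ = (m - log K)/sqrt v`,
`∫_ℝ max(eˣ - K, 0) φ_{m,v}(x) dx = e^{m + v/2} Φ(ξ + sqrt v) - K Φ(ξ)`. -/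
theorem stmt_17 (m v K : ℝ) (hv : 0 < v) (hK : 0 < K)
    (ξ : ℝ) (hξ : ξ = (m - Real.log K) / Real.sqrt v) :
    ∫ x : ℝ, max (Real.exp x - K) 0 * gaussianDens m v x
      = Real.exp (m + v / 2) * stdNormalCDF (ξ + Real.sqrt v) - K * stdNormalCDF ξ := by
  have hs : Real.sqrt v ≠ 0 := (Real.sqrt_pos.2 hv).ne'
  have hpayoff : (fun x ↦ max (Real.exp x - K) 0 * gaussianDens m v x) =
      (Set.Ioi (Real.log K)).indicator fun x ↦
        Real.exp (m + v / 2) * gaussianDens (m + v) v x - K * gaussianDens m v x := by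
    ext x
    by_cases hx : x ∈ Set.Ioi (Real.log K)
    · have hKx := (Real.log_lt_iff_lt_exp hK).1 hx
      rw [Set.indicator_of_mem hx, max_eq_left (by linarith), ← exp_mul_gaussianDens m hv, sub_mul]
    · have hKx := (Real.le_log_iff_exp_le hK).1 (not_lt.1 hx)
      rw [Set.indicator_of_notMem hx, max_eq_right (by linarith), zero_mul]
  have hshift : ξ + Real.sqrt v = (m + v - Real.log K) / Real.sqrt v := by
    rw [hξ, eq_div_iff hs, add_mul, div_mul_cancel₀ _ hs, Real.mul_self_sqrt hv.le]
    ring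
  rw [hpayoff, integral_indicator measurableSet_Ioi,
    integral_sub ((integrable_gaussianDens _ hv).integrableOn.const_mul _)
      ((integrable_gaussianDens _ hv).integrableOn.const_mul _),
    integral_const_mul, integral_const_mul, setIntegral_Ioi_gaussianDens _ _ hv,
    setIntegral_Ioi_gaussianDens _ _ hv, ← hshift, ← hξ]
end

section
/- Let m ∈ ℝ, v > 0, K > 0, set ξ = (m − log K)/sqrt(v), and for each natural number n define J_n = ∫_{−ξ}^{∞} (m + sqrt(v)·x)^n·φ(x) dx, where φ is the standard normal density. Then J_0 = Φ(ξ), J_1 = m·J_0 + sqrt(v)·φ(ξ), and for every n ≥ 2: J_n = m·J_{n−1} + v·(n − 1)·J_{n−2} + sqrt(v)·(log K)^{n−1}·φ(ξ). -/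
/-- The standard normal density `φ(u) = (2π)^(-1/2) e^(-u²/2)`. -/
noncomputable def stdNormalPDF (u : ℝ) : ℝ :=
  (Real.sqrt (2 * Real.pi))⁻¹ * Real.exp (-u ^ 2 / 2)

open MeasureTheory

theorem stdNormalPDF_neg (x : ℝ) : stdNormalPDF (-x) = stdNormalPDF x := by
  simp [stdNormalPDF]

theorem hasDerivAt_stdNormalPDF (x : ℝ) :
    HasDerivAt stdNormalPDF (-x * stdNormalPDF x) x := by
  have h : HasDerivAt (fun u : ℝ => -u ^ 2 / 2) (-x) x := by
    refine ((hasDerivAt_pow 2 x).neg.div_const 2).congr_deriv ?_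
    norm_num
    ring
  refine (h.exp.const_mul (Real.sqrt (2 * Real.pi))⁻¹).congr_deriv ?_
  simp only [stdNormalPDF]
  ring

theorem integrable_pow_mul_stdNormalPDF (n : ℕ) :
    Integrable (fun x : ℝ => x ^ n * stdNormalPDF x) := by
  have h := (integrable_rpow_mul_exp_neg_mul_sq (b := 1 / 2) (by norm_num) (s := n)
    (by linarith [Nat.cast_nonneg (α := ℝ) n])).const_mul (Real.sqrt (2 * Real.pi))⁻¹
  refine h.congr (Filter.Eventually.of_forall fun x => ?_)
  simp only [stdNormalPDF, Real.rpow_natCast]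
  rw [show -(1 / 2) * x ^ 2 = -x ^ 2 / 2 by ring]
  ring

theorem integrable_affine_pow_mul_stdNormalPDF (m s : ℝ) (n : ℕ) :
    Integrable (fun x : ℝ => (m + s * x) ^ n * stdNormalPDF x) := by
  simp only [add_pow, Finset.sum_mul]
  refine integrable_finsetSum _ fun k _ => ?_
  refine ((integrable_pow_mul_stdNormalPDF (n - k)).const_mul
    (m ^ k * s ^ (n - k) * (n.choose k : ℝ))).congr (Filter.Eventually.of_forall fun x => ?_)
  simp only [mul_pow]
  ring

/-- Integration by parts for truncated moments of an affine function of a standard Gaussian. -/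
theorem integral_Ioi_affine_pow_succ_mul_stdNormalPDF (m s a : ℝ) (n : ℕ) :
    ∫ x in Set.Ioi a, (m + s * x) ^ (n + 1) * stdNormalPDF x =
      m * (∫ x in Set.Ioi a, (m + s * x) ^ n * stdNormalPDF x)
        + s ^ 2 * n * (∫ x in Set.Ioi a, (m + s * x) ^ (n - 1) * stdNormalPDF x)
        + s * (m + s * a) ^ n * stdNormalPDF a := by
  have hint (k : ℕ) :
      IntegrableOn (fun x : ℝ => (m + s * x) ^ k * stdNormalPDF x) (Set.Ioi a) :=
    (integrable_affine_pow_mul_stdNormalPDF m s k).integrableOn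
  have hderiv (x : ℝ) : HasDerivAt (fun x => s * ((m + s * x) ^ n * stdNormalPDF x))
      (s ^ 2 * n * ((m + s * x) ^ (n - 1) * stdNormalPDF x)
        + m * ((m + s * x) ^ n * stdNormalPDF x)
        - (m + s * x) ^ (n + 1) * stdNormalPDF x) x := by
    have h : HasDerivAt (fun x : ℝ => m + s * x) s x := by
      simpa using ((hasDerivAt_id x).const_mul s).const_add m
    refine (((h.pow n).mul (hasDerivAt_stdNormalPDF x)).const_mul s).congr_deriv ?_
    simp only [Pi.pow_apply]
    ring
  have h1 := (hint (n - 1)).const_mul (s ^ 2 * n)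
  have h2 := (hint n).const_mul m
  have h12 : IntegrableOn (fun x : ℝ => s ^ 2 * n * ((m + s * x) ^ (n - 1) * stdNormalPDF x)
      + m * ((m + s * x) ^ n * stdNormalPDF x)) (Set.Ioi a) := h1.add h2
  have hint' := h12.sub (hint (n + 1))
  have hlim := tendsto_zero_of_hasDerivAt_of_integrableOn_Ioi (fun x _ => hderiv x) hint'
    ((hint n).const_mul s)
  have key := integral_Ioi_of_hasDerivAt_of_tendsto' (fun x _ => hderiv x) hint' hlim
  rw [integral_sub h12 (hint (n + 1)), integral_add h1 h2, integral_const_mul,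
    integral_const_mul] at key
  linarith

/-- Recursion for the truncated Gaussian moments
`J_n = ∫_{-ξ}^∞ (m + sqrt(v) x)ⁿ φ(x) dx` with `ξ = (m - log K)/sqrt v`:
`J_0 = Φ(ξ)`, `J_1 = m J_0 + sqrt(v) φ(ξ)`, and for `n ≥ 2`,
`J_n = m J_{n-1} + v (n - 1) J_{n-2} + sqrt(v) (log K)^{n-1} φ(ξ)`. -/
theorem stmt_18 (m v K : ℝ) (hv : 0 < v) (hK : 0 < K)
    (ξ : ℝ) (hξ : ξ = (m - Real.log K) / Real.sqrt v)
    (J : ℕ → ℝ)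
    (hJ : ∀ n : ℕ, J n = ∫ x in Set.Ioi (-ξ), (m + Real.sqrt v * x) ^ n * stdNormalPDF x) :
    J 0 = stdNormalCDF ξ ∧
    J 1 = m * J 0 + Real.sqrt v * stdNormalPDF ξ ∧
    ∀ n : ℕ, 2 ≤ n →
      J n = m * J (n - 1) + v * ((n : ℝ) - 1) * J (n - 2)
        + Real.sqrt v * (Real.log K) ^ (n - 1) * stdNormalPDF ξ := by
  have hs : Real.sqrt v ≠ 0 := (Real.sqrt_pos.mpr hv).ne'
  have hlow : m + Real.sqrt v * -ξ = Real.log K := by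
    rw [hξ]
    field_simp
    ring
  have hrec (n : ℕ) : J (n + 1) = m * J n + v * n * J (n - 1)
      + Real.sqrt v * Real.log K ^ n * stdNormalPDF ξ := by
    rw [hJ, hJ, hJ, integral_Ioi_affine_pow_succ_mul_stdNormalPDF, hlow, stdNormalPDF_neg,
      Real.sq_sqrt hv.le]
  refine ⟨?_, ?_, fun n hn => ?_⟩
  · rw [hJ, ← integral_comp_neg_Iic]
    simp [stdNormalCDF, stdNormalPDF]
  · simpa using hrec 0
  · obtain ⟨k, rfl⟩ := Nat.exists_eq_add_of_le' hn
    simpa [add_sub_assoc, show k + 2 - 1 = k + 1 from rfl,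
      show (2 : ℝ) - 1 = 1 by norm_num] using hrec (k + 1)
end
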